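/- Let A be a complete atomic weakly associative relation algebra and let (B(A), T_κ, E_{κλ})_{κ,λ<3} be the suitable structure built from A. Define φ : A → P(B(A)) by φ(x) = {t ∈ B(A) : t₂ ≤ x}. Then φ is an isomorphism from A onto Ra Cm B(A); that is, φ is a bijection from A onto Nr₂ = {X ⊆ B(A) : T*₂(X) = X}, and for all x,y ∈ A: φ(x+y) = φ(x)∪φ(y), φ(‾x) = B(A)∖φ(x), φ(1') = E₀₁, φ(x;y) = φ(x);φ(y), and φ(x⌣) = φ(x)⌣ (where ; and ⌣ on Nr₂ are the reduct operations defined below). -/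

import Mathlib

universe u

/-- A weakly associative relation algebra: a Boolean algebra equipped with
relative multiplication `comp`, converse `conv`, and identity `one'`
satisfying the WA axioms. -/
structure WA (A : Type*) [BooleanAlgebra A] where
  comp : A → A → A
  conv : A → A
  one' : A
  wassoc : ∀ x : A, comp (comp (x ⊓ one') ⊤) ⊤ = comp (x ⊓ one') ⊤
  rdist : ∀ x y z : A, comp (x ⊔ y) z = comp x z ⊔ comp y z
  comp_one' : ∀ x : A, comp x one' = x
  conv_conv : ∀ x : A, conv (conv x) = x
  conv_sup : ∀ x y : A, conv (x ⊔ y) = conv x ⊔ conv y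
  conv_comp : ∀ x y : A, conv (comp x y) = comp (conv y) (conv x)
  tarski : ∀ x y : A, comp (conv x) (comp x y)ᶜ ≤ yᶜ

variable {A : Type u}

/-- The base set of the suitable structure of an atomic WA:
triples of atoms `s` with `s 1 ≤ s 2 ; s 0`. -/
def BAset [BooleanAlgebra A] (W : WA A) : Set (Fin 3 → A) :=
  {s | (∀ i : Fin 3, IsAtom (s i)) ∧ s 1 ≤ W.comp (s 2) (s 0)}

/-- The relation `T_κ = {(s,t) ∈ B(A)×B(A) : s κ = t κ}`. -/
def Tk [BooleanAlgebra A] (W : WA A) (κ : Fin 3) :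
    Set ((Fin 3 → A) × (Fin 3 → A)) :=
  {p | p.1 ∈ BAset W ∧ p.2 ∈ BAset W ∧ p.1 κ = p.2 κ}

/-- The sets `E_{κλ}`: all of `B(A)` when `κ = λ`, and otherwise the triples
whose entry at the third index `μ ∉ {κ,λ}` is a subidentity atom. -/
def Ee [BooleanAlgebra A] (W : WA A) (κ lam : Fin 3) : Set (Fin 3 → A) :=
  if κ = lam then BAset W
  else {s | s ∈ BAset W ∧ ∀ μ : Fin 3, μ ≠ κ → μ ≠ lam → s μ ≤ W.one'}

/-- The operator `T*_κ(X) = {s ∈ B(A) : s κ = t κ for some t ∈ X}`. -/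
def Tstar [BooleanAlgebra A] (W : WA A) (κ : Fin 3) (X : Set (Fin 3 → A)) :
    Set (Fin 3 → A) :=
  {s | s ∈ BAset W ∧ ∃ t ∈ X, s κ = t κ}

/-- The set of 2-dimensional elements of the complex algebra `Cm B(A)`. -/
def Nr2 [BooleanAlgebra A] (W : WA A) : Set (Set (Fin 3 → A)) :=
  {X | X ⊆ BAset W ∧ Tstar W 2 X = X}

/-- Relative multiplication of the relation-algebraic reduct `Ra Cm B(A)`. -/
def raComp [BooleanAlgebra A] (W : WA A) (X Y : Set (Fin 3 → A)) :
    Set (Fin 3 → A) :=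
  Tstar W 2 (Tstar W 1 (Ee W 1 2 ∩ X) ∩ Tstar W 0 (Ee W 0 2 ∩ Y))

/-- Converse of the relation-algebraic reduct `Ra Cm B(A)`. -/
def raConv [BooleanAlgebra A] (W : WA A) (X : Set (Fin 3 → A)) :
    Set (Fin 3 → A) :=
  Tstar W 2 (Ee W 2 0 ∩ Tstar W 0 (Ee W 0 1 ∩ Tstar W 1 (Ee W 1 2 ∩ X)))

/-- The map `φ(x) = {t ∈ B(A) : t 2 ≤ x}`. -/
def phi [BooleanAlgebra A] (W : WA A) (x : A) : Set (Fin 3 → A) :=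
  {t | t ∈ BAset W ∧ t 2 ≤ x}

namespace WA

section BooleanAlgebra

variable [BooleanAlgebra A] (W : WA A)

theorem conv_mono {x y : A} (h : x ≤ y) : W.conv x ≤ W.conv y := by
  rw [← sup_eq_right, ← W.conv_sup, sup_eq_right.2 h]

theorem conv_le_iff {x y : A} : W.conv x ≤ y ↔ x ≤ W.conv y :=
  ⟨fun h => W.conv_conv x ▸ W.conv_mono h, fun h => W.conv_conv y ▸ W.conv_mono h⟩

theorem comp_mono_left {x y : A} (z : A) (h : x ≤ y) : W.comp x z ≤ W.comp y z := by
  rw [← sup_eq_right, ← W.rdist, sup_eq_right.2 h]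

theorem comp_mono_right (z : A) {x y : A} (h : x ≤ y) : W.comp z x ≤ W.comp z y := by
  rw [← W.conv_conv (W.comp z y), ← W.conv_le_iff, W.conv_comp, W.conv_comp]
  exact (W.comp_mono_left _ (W.conv_mono h))

theorem comp_mono {x x' y y' : A} (hx : x ≤ x') (hy : y ≤ y') :
    W.comp x y ≤ W.comp x' y' :=
  (W.comp_mono_left y hx).trans (W.comp_mono_right x' hy)

theorem conv_one' : W.conv W.one' = W.one' := by
  have h := W.conv_comp (W.conv W.one') W.one'
  rwa [W.comp_one', W.conv_conv, W.comp_one', eq_comm] at h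

theorem one'_comp (x : A) : W.comp W.one' x = x := by
  rw [← W.conv_conv (W.comp W.one' x), W.conv_comp, W.conv_one', W.comp_one', W.conv_conv]

theorem isAtom_conv {a : A} (ha : IsAtom a) : IsAtom (W.conv a) := by
  have hbot : W.conv ⊥ = ⊥ := le_bot_iff.1 (W.conv_le_iff.2 bot_le)
  refine ⟨fun h => ha.1 ?_, fun b hb => ?_⟩
  · rw [← W.conv_conv a, h, hbot]
  · have hlt : W.conv b < a := by
      refine lt_of_le_not_ge (W.conv_le_iff.2 hb.le) fun h => hb.not_ge (W.conv_le_iff.2 h)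
    rw [← W.conv_conv b, ha.2 _ hlt, hbot]

theorem disjoint_conv_comp {x y z : A} (h : Disjoint (W.comp x y) z) :
    Disjoint (W.comp (W.conv x) z) y :=
  le_compl_iff_disjoint_right.1 <|
    (W.comp_mono_right _ (le_compl_iff_disjoint_left.2 h)).trans (W.tarski x y)

theorem disjoint_conv_comp_iff {x y z : A} :
    Disjoint (W.comp (W.conv x) z) y ↔ Disjoint (W.comp x y) z :=
  ⟨fun h => W.conv_conv x ▸ W.disjoint_conv_comp h, W.disjoint_conv_comp⟩

theorem disjoint_conv_iff {x y : A} : Disjoint (W.conv x) y ↔ Disjoint x (W.conv y) := by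
  have key : ∀ x y : A, Disjoint x y → Disjoint (W.conv x) (W.conv y) := by
    intro x y h c hx hy
    have hc : W.conv c ≤ ⊥ := h (W.conv_le_iff.2 hx) (W.conv_le_iff.2 hy)
    exact (W.conv_le_iff.1 hc).trans (W.conv_le_iff.2 bot_le)
  exact ⟨fun h => W.conv_conv x ▸ key _ _ h, fun h => W.conv_conv y ▸ key _ _ h⟩

theorem disjoint_comp_conv_iff {x y z : A} :
    Disjoint (W.comp z (W.conv y)) x ↔ Disjoint (W.comp x y) z := by
  rw [← W.conv_conv (W.comp z (W.conv y)), W.conv_comp, W.disjoint_conv_iff,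
    W.disjoint_conv_comp_iff, ← W.conv_comp, W.disjoint_conv_iff, W.conv_conv]

theorem le_conv_comp_iff {a b c : A} (hb : IsAtom b) (hc : IsAtom c) :
    b ≤ W.comp (W.conv a) c ↔ c ≤ W.comp a b := by
  rw [← hb.not_disjoint_iff_le, ← hc.not_disjoint_iff_le, disjoint_comm,
    W.disjoint_conv_comp_iff, disjoint_comm]

theorem le_comp_conv_iff {a b c : A} (ha : IsAtom a) (hc : IsAtom c) :
    a ≤ W.comp c (W.conv b) ↔ c ≤ W.comp a b := by
  rw [← ha.not_disjoint_iff_le, ← hc.not_disjoint_iff_le, disjoint_comm,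
    W.disjoint_comp_conv_iff, disjoint_comm]

theorem eq_conv_of_one'_atom_le_comp {a b i : A} (ha : IsAtom a) (hb : IsAtom b) (hi : IsAtom i)
    (hi1 : i ≤ W.one') (h : i ≤ W.comp a b) : b = W.conv a := by
  have hle : b ≤ W.comp (W.conv a) i := (W.le_conv_comp_iff hb hi).2 h
  refine ((W.isAtom_conv ha).le_iff_eq hb.1).1 (hle.trans ?_)
  simpa only [W.comp_one'] using W.comp_mono_right (W.conv a) hi1

section IsAtomic

variable [IsAtomic A]

theorem exists_atom_of_le_comp {c x y : A} (hc : IsAtom c) (h : c ≤ W.comp x y) :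
    ∃ a b, IsAtom a ∧ IsAtom b ∧ a ≤ x ∧ b ≤ y ∧ c ≤ W.comp a b := by
  have atom_le : ∀ u v : A, ¬ Disjoint u v → ∃ a, IsAtom a ∧ a ≤ u ∧ a ≤ v := by
    intro u v huv
    obtain ⟨a, ha, hle⟩ := (IsAtomic.eq_bot_or_exists_atom_le (u ⊓ v)).resolve_left
      (fun h => huv (disjoint_iff.2 h))
    exact ⟨a, ha, hle.trans inf_le_left, hle.trans inf_le_right⟩
  have hxy : ¬ Disjoint (W.comp x y) c := by rwa [disjoint_comm, hc.not_disjoint_iff_le]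
  obtain ⟨b, hb, hbx, hby⟩ := atom_le _ _ (fun h => hxy (W.disjoint_conv_comp_iff.1 h))
  have hxb : ¬ Disjoint (W.comp x b) c := fun h =>
    (hb.not_disjoint_iff_le.2 hbx) (W.disjoint_conv_comp h).symm
  obtain ⟨a, ha, hac, hax⟩ := atom_le _ _ (fun h => hxb (W.disjoint_comp_conv_iff.1 h))
  exact ⟨a, b, ha, hb, hax, hby, (W.le_comp_conv_iff ha hc).1 hac⟩

theorem exists_right_one'_atom {a : A} (ha : IsAtom a) :
    ∃ i, IsAtom i ∧ i ≤ W.one' ∧ a ≤ W.comp a i := by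
  obtain ⟨b, i, -, hi, hba, hi1, h⟩ :=
    W.exists_atom_of_le_comp ha (W.comp_one' a).ge
  exact ⟨i, hi, hi1, h.trans (W.comp_mono_left _ hba)⟩

theorem exists_left_one'_atom {a : A} (ha : IsAtom a) :
    ∃ i, IsAtom i ∧ i ≤ W.one' ∧ a ≤ W.comp i a := by
  obtain ⟨i, b, hi, -, hi1, hba, h⟩ :=
    W.exists_atom_of_le_comp ha (W.one'_comp a).ge
  exact ⟨i, hi, hi1, h.trans (W.comp_mono_right _ hba)⟩

theorem exists_one'_atom_le_comp_conv {a : A} (ha : IsAtom a) :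
    ∃ i, IsAtom i ∧ i ≤ W.one' ∧ i ≤ W.comp a (W.conv a) := by
  obtain ⟨i, hi, hi1, h⟩ := W.exists_left_one'_atom ha
  exact ⟨i, hi, hi1, (W.le_comp_conv_iff hi ha).2 h⟩

end IsAtomic

theorem mem_BAset_cons {a b c : A} (ha : IsAtom a) (hb : IsAtom b) (hc : IsAtom c)
    (h : b ≤ W.comp c a) : ![a, b, c] ∈ BAset W :=
  ⟨by simp [Fin.forall_fin_succ, ha, hb, hc], h⟩

theorem mem_Ee_zero_one {s : Fin 3 → A} : s ∈ Ee W 0 1 ↔ s ∈ BAset W ∧ s 2 ≤ W.one' := by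
  simp [Ee, Fin.forall_fin_succ]

theorem mem_Ee_one_two {s : Fin 3 → A} : s ∈ Ee W 1 2 ↔ s ∈ BAset W ∧ s 0 ≤ W.one' := by
  simp [Ee, Fin.forall_fin_succ]

theorem mem_Ee_zero_two {s : Fin 3 → A} : s ∈ Ee W 0 2 ↔ s ∈ BAset W ∧ s 1 ≤ W.one' := by
  simp [Ee, Fin.forall_fin_succ]

theorem mem_Ee_two_zero {s : Fin 3 → A} : s ∈ Ee W 2 0 ↔ s ∈ BAset W ∧ s 1 ≤ W.one' := by
  simp [Ee, Fin.forall_fin_succ]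

theorem eq_of_mem_Ee_one_two {s : Fin 3 → A} (h : s ∈ Ee W 1 2) : s 1 = s 2 := by
  obtain ⟨hs, h0⟩ := W.mem_Ee_one_two.1 h
  refine ((hs.1 2).le_iff_eq (hs.1 1).1).1 (hs.2.trans ?_)
  simpa only [W.comp_one'] using W.comp_mono_right (s 2) h0

theorem eq_of_mem_Ee_zero_one {s : Fin 3 → A} (h : s ∈ Ee W 0 1) : s 1 = s 0 := by
  obtain ⟨hs, h2⟩ := W.mem_Ee_zero_one.1 h
  refine ((hs.1 0).le_iff_eq (hs.1 1).1).1 (hs.2.trans ?_)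
  simpa only [W.one'_comp] using W.comp_mono_left (s 0) h2

theorem eq_conv_of_mem_Ee_zero_two {s : Fin 3 → A} (h : s ∈ Ee W 0 2) :
    s 0 = W.conv (s 2) := by
  obtain ⟨hs, h1⟩ := W.mem_Ee_zero_two.1 h
  exact W.eq_conv_of_one'_atom_le_comp (hs.1 2) (hs.1 0) (hs.1 1) h1 hs.2

theorem Ee_two_zero : Ee W 2 0 = Ee W 0 2 := by
  ext s
  rw [W.mem_Ee_two_zero, W.mem_Ee_zero_two]

section IsAtomic

variable [IsAtomic A]

theorem mem_Tstar_one_phi {x : A} {s : Fin 3 → A} :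
    s ∈ Tstar W 1 (Ee W 1 2 ∩ phi W x) ↔ s ∈ BAset W ∧ s 1 ≤ x := by
  constructor
  · rintro ⟨hs, u, ⟨huE, -, hux⟩, hsu⟩
    exact ⟨hs, by rwa [hsu, W.eq_of_mem_Ee_one_two huE]⟩
  · rintro ⟨hs, hsx⟩
    obtain ⟨i, hi, hi1, h⟩ := W.exists_right_one'_atom (hs.1 1)
    have hB := W.mem_BAset_cons hi (hs.1 1) (hs.1 1) h
    exact ⟨hs, ![i, s 1, s 1], ⟨W.mem_Ee_one_two.2 ⟨hB, hi1⟩, hB, hsx⟩, rfl⟩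

theorem mem_Tstar_zero_phi {x : A} {s : Fin 3 → A} :
    s ∈ Tstar W 0 (Ee W 0 2 ∩ phi W x) ↔ s ∈ BAset W ∧ W.conv (s 0) ≤ x := by
  constructor
  · rintro ⟨hs, u, ⟨huE, -, hux⟩, hsu⟩
    exact ⟨hs, by rwa [hsu, W.eq_conv_of_mem_Ee_zero_two huE, W.conv_conv]⟩
  · rintro ⟨hs, hsx⟩
    have ha := W.isAtom_conv (hs.1 0)
    obtain ⟨i, hi, hi1, h⟩ := W.exists_one'_atom_le_comp_conv ha
    rw [W.conv_conv] at h
    have hB := W.mem_BAset_cons (hs.1 0) hi ha h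
    exact ⟨hs, ![s 0, i, W.conv (s 0)], ⟨W.mem_Ee_zero_two.2 ⟨hB, hi1⟩, hB, hsx⟩, rfl⟩

theorem mem_Tstar_zero_Ee_inter {x : A} {s : Fin 3 → A} :
    s ∈ Tstar W 0 (Ee W 0 1 ∩ Tstar W 1 (Ee W 1 2 ∩ phi W x)) ↔
      s ∈ BAset W ∧ s 0 ≤ x := by
  constructor
  · rintro ⟨hs, u, ⟨huE, hu⟩, hsu⟩
    exact ⟨hs, by rw [hsu, ← W.eq_of_mem_Ee_zero_one huE]; exact (W.mem_Tstar_one_phi.1 hu).2⟩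
  · rintro ⟨hs, hsx⟩
    obtain ⟨i, hi, hi1, h⟩ := W.exists_left_one'_atom (hs.1 0)
    have hB := W.mem_BAset_cons (hs.1 0) (hs.1 0) hi h
    exact ⟨hs, ![s 0, s 0, i],
      ⟨W.mem_Ee_zero_one.2 ⟨hB, hi1⟩, W.mem_Tstar_one_phi.2 ⟨hB, hsx⟩⟩, rfl⟩

theorem phi_comp (x y : A) : phi W (W.comp x y) = raComp W (phi W x) (phi W y) := by
  ext s
  constructor
  · rintro ⟨hs, hsxy⟩
    obtain ⟨a, b, ha, hb, hax, hby, h⟩ := W.exists_atom_of_le_comp (hs.1 2) hsxy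
    have hB := W.mem_BAset_cons (W.isAtom_conv hb) ha (hs.1 2)
      ((W.le_comp_conv_iff ha (hs.1 2)).2 h)
    exact ⟨hs, ![W.conv b, a, s 2], ⟨W.mem_Tstar_one_phi.2 ⟨hB, hax⟩,
      W.mem_Tstar_zero_phi.2 ⟨hB, (W.conv_conv b).trans_le hby⟩⟩, rfl⟩
  · rintro ⟨hs, t, ⟨h1, h0⟩, hst⟩
    obtain ⟨ht, htx⟩ := W.mem_Tstar_one_phi.1 h1
    obtain ⟨-, hty⟩ := W.mem_Tstar_zero_phi.1 h0
    refine ⟨hs, hst.trans_le ?_⟩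
    exact ((W.le_comp_conv_iff (ht.1 2) (ht.1 1)).2 ht.2).trans (W.comp_mono htx hty)

theorem phi_conv (x : A) : phi W (W.conv x) = raConv W (phi W x) := by
  ext s
  constructor
  · rintro ⟨hs, hsx⟩
    obtain ⟨i, hi, hi1, h⟩ := W.exists_one'_atom_le_comp_conv (hs.1 2)
    have hB := W.mem_BAset_cons (W.isAtom_conv (hs.1 2)) hi (hs.1 2) h
    exact ⟨hs, ![W.conv (s 2), i, s 2], ⟨W.mem_Ee_two_zero.2 ⟨hB, hi1⟩,
      W.mem_Tstar_zero_Ee_inter.2 ⟨hB, W.conv_le_iff.2 hsx⟩⟩, rfl⟩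
  · rintro ⟨hs, t, ⟨hE, h0⟩, hst⟩
    obtain ⟨-, htx⟩ := W.mem_Tstar_zero_Ee_inter.1 h0
    rw [Ee_two_zero] at hE
    rw [W.eq_conv_of_mem_Ee_zero_two hE, W.conv_le_iff] at htx
    exact ⟨hs, hst.trans_le htx⟩

theorem le_of_phi_subset {x y : A} (h : phi W x ⊆ phi W y) : x ≤ y := by
  refine BooleanAlgebra.le_iff_atom_le_imp.2 fun a ha hax => ?_
  obtain ⟨i, hi, -, hai⟩ := W.exists_right_one'_atom ha
  exact (h (a := ![i, a, a]) ⟨W.mem_BAset_cons hi ha ha hai, hax⟩).2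

theorem phi_injective : Function.Injective (phi W) := fun _ _ h =>
  le_antisymm (W.le_of_phi_subset h.le) (W.le_of_phi_subset h.ge)

end IsAtomic

theorem phi_mem_Nr2 (x : A) : phi W x ∈ Nr2 W := by
  refine ⟨fun s hs => hs.1, Set.Subset.antisymm ?_ fun s hs => ⟨hs.1, s, hs, rfl⟩⟩
  rintro s ⟨hs, t, ht, hst⟩
  exact ⟨hs, hst.trans_le ht.2⟩

theorem phi_sup (x y : A) : phi W (x ⊔ y) = phi W x ∪ phi W y := by
  ext s
  constructor
  · rintro ⟨hs, h⟩
    by_cases hx : s 2 ≤ x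
    · exact Or.inl ⟨hs, hx⟩
    · exact Or.inr ⟨hs, ((hs.1 2).not_le_iff_disjoint.1 hx).left_le_of_le_sup_left h⟩
  · rintro (⟨hs, h⟩ | ⟨hs, h⟩)
    · exact ⟨hs, le_sup_of_le_left h⟩
    · exact ⟨hs, le_sup_of_le_right h⟩

theorem phi_compl (x : A) : phi W xᶜ = BAset W \ phi W x := by
  ext s
  refine and_congr_right fun hs => ?_
  rw [le_compl_iff_disjoint_right, ← (hs.1 2).not_le_iff_disjoint]
  exact not_congr (and_iff_right hs).symm

theorem phi_one' : phi W W.one' = Ee W 0 1 := by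
  ext s
  exact W.mem_Ee_zero_one.symm

end BooleanAlgebra

theorem exists_phi_eq [CompleteBooleanAlgebra A] (W : WA A) {X : Set (Fin 3 → A)}
    (hX : X ∈ Nr2 W) : ∃ x : A, phi W x = X := by
  refine ⟨sSup ((fun t => t 2) '' X), Set.Subset.antisymm ?_ fun t ht =>
    ⟨hX.1 ht, le_sSup ⟨t, ht, rfl⟩⟩⟩
  rintro s ⟨hs, hle⟩
  obtain ⟨_, ⟨t, ht, rfl⟩, hst⟩ := (hs.1 2).le_sSup.1 hle
  rw [← hX.2]
  exact ⟨hs, t, ht, (((hX.1 ht).1 2).le_iff_eq (hs.1 2).1).1 hst⟩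

end WA

/-- For a complete atomic WA `A`, `φ` is an isomorphism from `A` onto the
relation-algebraic reduct `Ra Cm B(A)`. -/
theorem stmt_11 [CompleteBooleanAlgebra A] (W : WA A)
    (hatomic : ∀ x : A, x ≠ ⊥ → ∃ a : A, IsAtom a ∧ a ≤ x) :
    Function.Injective (phi W) ∧
    (∀ x : A, phi W x ∈ Nr2 W) ∧
    (∀ X ∈ Nr2 W, ∃ x : A, phi W x = X) ∧
    (∀ x y : A, phi W (x ⊔ y) = phi W x ∪ phi W y) ∧
    (∀ x : A, phi W xᶜ = BAset W \ phi W x) ∧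
    phi W W.one' = Ee W 0 1 ∧
    (∀ x y : A, phi W (W.comp x y) = raComp W (phi W x) (phi W y)) ∧
    (∀ x : A, phi W (W.conv x) = raConv W (phi W x)) := by
  have : IsAtomic A := ⟨fun x => or_iff_not_imp_left.2 (hatomic x)⟩
  exact ⟨W.phi_injective, W.phi_mem_Nr2, fun _ hX => W.exists_phi_eq hX, W.phi_sup,
    W.phi_compl, W.phi_one', W.phi_comp, W.phi_conv⟩
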